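/- Suppose ‖∇log α₀(x)‖ ≤ L₀, ‖∇²log α₀(x)‖ ≤ L₀ for all x ∈ 𝒳, and the velocity field f satisfies ‖∇^i f(t,x)‖ ≤ L_f and ‖∇^i div f(t,x)‖ ≤ L_f for i ∈ {1,2} and all t ∈ [0,T], x ∈ 𝒳, with f(t,·) l-periodic. Then the Hessian of the log of the transported density ρ¹_t = X(t,·;f)♯α₀ satisfies, for every t ∈ [0,T] and x ∈ 𝒳, ‖∇²log ρ¹_t(x)‖ ≤ (L₀ + t(L_f + B₁ L_f)) exp(2 t L_f), where B₁ = (L₀ + T L_f) exp(T L_f). In particular, ∇log ρ¹_t is Lipschitz continuous on 𝒳 uniformly over t ∈ [0,T]. -/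

import Mathlib

open MeasureTheory Set

noncomputable section

abbrev E (d : ℕ) := EuclideanSpace ℝ (Fin d)

def uvec (d : ℕ) (i : Fin d) : E d := EuclideanSpace.single i (1 : ℝ)

def box (d : ℕ) (l : ℝ) : Set (E d) := {x | ∀ i, x i ∈ Icc (-(l / 2)) (l / 2)}

def IsPeriodic {d : ℕ} {β : Type*} (l : ℝ) (g : E d → β) : Prop :=
  ∀ (x : E d) (i : Fin d), g (x + l • uvec d i) = g x

/-- Divergence of a vector field on `ℝ^d`. -/
def diverg {d : ℕ} (F : E d → E d) (x : E d) : ℝ :=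
  ∑ i, fderiv ℝ F x (uvec d i) i

/-- The score (gradient of the log-density) of a positive density. -/
def score {d : ℕ} (g : E d → ℝ) (x : E d) : E d :=
  gradient (fun y => Real.log (g y)) x

section ODE

variable {V : Type*} [NormedAddCommGroup V] [NormedSpace ℝ V]

theorem gronwallBound_le {δ K ε x : ℝ} (hK : 0 ≤ K) (hε : 0 ≤ ε) :
    gronwallBound δ K ε x ≤ (δ + ε * x) * Real.exp (K * x) := by
  rcases hK.eq_or_lt with rfl | hK
  · simp [gronwallBound_K0]
  · rw [gronwallBound_of_K_ne_0 hK.ne']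
    have h1 : Real.exp (K * x) - 1 ≤ (K * x) * Real.exp (K * x) := by
      have h := Real.add_one_le_exp (-(K * x))
      have h2 : Real.exp (-(K * x)) * Real.exp (K * x) = 1 := by
        rw [← Real.exp_add]; simp
      nlinarith [Real.exp_pos (K * x)]
    have h3 : ε / K * (Real.exp (K * x) - 1) ≤ ε / K * ((K * x) * Real.exp (K * x)) :=
      mul_le_mul_of_nonneg_left h1 (by positivity)
    have h4 : ε / K * ((K * x) * Real.exp (K * x)) = ε * x * Real.exp (K * x) := by
      field_simp
    simp only
    linarith

theorem norm_le_of_norm_hasDerivWithinAt_le_of_le {g g' : ℝ → V} {a b K ε : ℝ}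
    (hK : 0 ≤ K) (hε : 0 ≤ ε)
    (hg : ∀ t ∈ Icc a b, HasDerivWithinAt g (g' t) (Icc a b) t)
    (bound : ∀ t ∈ Icc a b, ‖g' t‖ ≤ K * ‖g t‖ + ε) {s t : ℝ}
    (ht : t ∈ Icc a b) (hs : s ∈ Icc a b) (hts : t ≤ s) :
    ‖g s‖ ≤ (‖g t‖ + ε * (s - t)) * Real.exp (K * (s - t)) := by
  refine (norm_le_gronwallBound_of_norm_deriv_right_le (f := g) (f' := g') (a := t) (b := s)
    ?_ ?_ le_rfl ?_ s ⟨hts, le_rfl⟩).trans (gronwallBound_le hK hε)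
  · exact fun r hr => ((hg r ⟨ht.1.trans hr.1, hr.2.trans hs.2⟩).continuousWithinAt).mono
      (Icc_subset_Icc ht.1 hs.2)
  · intro r hr
    refine (hg r ⟨ht.1.trans hr.1, hr.2.le.trans hs.2⟩).mono_of_mem_nhdsWithin ?_
    filter_upwards [self_mem_nhdsWithin, mem_nhdsWithin_of_mem_nhds (Iio_mem_nhds hr.2)]
      with y hy hys
    exact ⟨(ht.1.trans hr.1).trans hy, hys.le.trans hs.2⟩
  · exact fun r hr => bound r ⟨ht.1.trans hr.1, hr.2.le.trans hs.2⟩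

/-- A two-sided Grönwall inequality. -/
theorem norm_le_of_norm_hasDerivWithinAt_le {g g' : ℝ → V} {a b K ε : ℝ}
    (hK : 0 ≤ K) (hε : 0 ≤ ε)
    (hg : ∀ t ∈ Icc a b, HasDerivWithinAt g (g' t) (Icc a b) t)
    (bound : ∀ t ∈ Icc a b, ‖g' t‖ ≤ K * ‖g t‖ + ε) {s t : ℝ}
    (ht : t ∈ Icc a b) (hs : s ∈ Icc a b) :
    ‖g s‖ ≤ (‖g t‖ + ε * |s - t|) * Real.exp (K * |s - t|) := by
  rcases le_total t s with h | h
  · rw [abs_of_nonneg (sub_nonneg.2 h)]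
    exact norm_le_of_norm_hasDerivWithinAt_le_of_le hK hε hg bound ht hs h
  · have key := norm_le_of_norm_hasDerivWithinAt_le_of_le (g := fun r => g (-r))
      (g' := fun r => -g' (-r)) (a := -b) (b := -a) (s := -s) (t := -t) hK hε ?_ ?_
      ⟨neg_le_neg ht.2, neg_le_neg ht.1⟩ ⟨neg_le_neg hs.2, neg_le_neg hs.1⟩ (neg_le_neg h)
    · rw [abs_of_nonpos (sub_nonpos.2 h)]
      simp only [neg_neg] at key
      rwa [show -(s - t) = -s - -t by ring]
    · intro r hr
      have hr' : -r ∈ Icc a b := ⟨by linarith [hr.2], by linarith [hr.1]⟩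
      have := (hg (-r) hr').scomp r (hasDerivAt_neg r).hasDerivWithinAt
        (s := Icc (-b) (-a)) (fun y hy => ⟨by linarith [hy.2], by linarith [hy.1]⟩)
      simpa using! this
    · intro r hr
      have hr' : -r ∈ Icc a b := ⟨by linarith [hr.2], by linarith [hr.1]⟩
      simpa using bound _ hr'

/-- Global existence for a bounded Lipschitz vector field. -/
theorem exists_solution_of_lipschitz_of_bounded [CompleteSpace V] {v : ℝ → V → V}
    {a b B K t₀ : ℝ} (ht₀ : t₀ ∈ Icc a b) (x₀ : V)
    (hlip : ∀ t ∈ Icc a b, ∀ x y, ‖v t x - v t y‖ ≤ K * ‖x - y‖)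
    (hcont : ∀ x, ContinuousOn (v · x) (Icc a b))
    (hbdd : ∀ t ∈ Icc a b, ∀ x, ‖v t x‖ ≤ B) :
    ∃ X : ℝ → V, X t₀ = x₀ ∧ ∀ t ∈ Icc a b, HasDerivWithinAt X (v t (X t)) (Icc a b) t := by
  have hPL : IsPicardLindelof v (tmin := a) (tmax := b) ⟨t₀, ht₀⟩ x₀
      (B.toNNReal * (b - a).toNNReal) 0 B.toNNReal K.toNNReal := by
    refine ⟨fun t ht => ?_, fun x _ => hcont x, fun t ht x _ => ?_, ?_⟩
    · refine (LipschitzWith.of_dist_le_mul fun x y => ?_).lipschitzOnWith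
      rw [dist_eq_norm, dist_eq_norm]
      exact (hlip t ht x y).trans
        (mul_le_mul_of_nonneg_right (Real.le_coe_toNNReal K) (norm_nonneg _))
    · exact (hbdd t ht x).trans (Real.le_coe_toNNReal B)
    · have hab : 0 ≤ b - a := sub_nonneg.2 (ht₀.1.trans ht₀.2)
      push_cast
      rw [Real.coe_toNNReal _ hab, sub_zero]
      refine mul_le_mul_of_nonneg_left (max_le ?_ ?_) (by positivity)
      · exact sub_le_sub_left ht₀.1 b
      · exact sub_le_sub_right ht₀.2 a
  exact hPL.exists_eq_forall_mem_Icc_hasDerivWithinAt₀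

theorem norm_radial_sub_le {R : ℝ} (hR : 0 < R) (p q : V) :
    ‖(R / max R ‖p‖) • p - (R / max R ‖q‖) • q‖ ≤ 2 * ‖p - q‖ := by
  set m := max R ‖p‖
  set n := max R ‖q‖
  have hm : R ≤ m := le_max_left _ _
  have hn : R ≤ n := le_max_left _ _
  have hqn : ‖q‖ ≤ n := le_max_right _ _
  have hm0 : 0 < m := hR.trans_le hm
  have hn0 : 0 < n := hR.trans_le hn
  have hmn : |n - m| ≤ ‖p - q‖ := by
    have h1 := abs_max_sub_max_le_abs ‖q‖ ‖p‖ R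
    rw [max_comm, max_comm ‖p‖] at h1
    refine h1.trans ((abs_norm_sub_norm_le q p).trans_eq (norm_sub_rev _ _))
  have hid : (R / m) • p - (R / n) • q = (R / m) • (p - q) + (R / m * ((n - m) / n)) • q := by
    have : R / n = R / m - R / m * ((n - m) / n) := by field_simp; ring
    rw [this, sub_smul, smul_sub]; abel
  have hRm : R / m ≤ 1 := (div_le_one hm0).2 hm
  have hRm0 : 0 ≤ R / m := by positivity
  rw [hid]
  refine (norm_add_le _ _).trans ?_
  rw [norm_smul, norm_smul, norm_mul, Real.norm_of_nonneg hRm0, Real.norm_eq_abs, abs_div,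
    abs_of_pos hn0]
  have h1 : R / m * ‖p - q‖ ≤ ‖p - q‖ := mul_le_of_le_one_left (norm_nonneg _) hRm
  have h2 : R / m * (|n - m| / n) * ‖q‖ ≤ ‖p - q‖ := by
    calc R / m * (|n - m| / n) * ‖q‖ = (R / m) * (|n - m| * (‖q‖ / n)) := by ring
      _ ≤ 1 * (‖p - q‖ * 1) := by
          gcongr
          exact (div_le_one hn0).2 hqn
      _ = ‖p - q‖ := by ring
  linarith

/-- Global existence for a linear inhomogeneous ODE. -/
theorem exists_solution_linear [CompleteSpace V] {A : ℝ → V →L[ℝ] V} {c : ℝ → V}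
    {a b K C t₀ : ℝ} (ht₀ : t₀ ∈ Icc a b) (x₀ : V) (hK : 0 ≤ K) (hC : 0 ≤ C)
    (hA : ContinuousOn A (Icc a b)) (hc : ContinuousOn c (Icc a b))
    (hAb : ∀ t ∈ Icc a b, ‖A t‖ ≤ K) (hcb : ∀ t ∈ Icc a b, ‖c t‖ ≤ C) :
    ∃ p : ℝ → V, p t₀ = x₀ ∧
      ∀ t ∈ Icc a b, HasDerivWithinAt p (A t (p t) + c t) (Icc a b) t := by
  set R : ℝ := (‖x₀‖ + C * (b - a)) * Real.exp (K * (b - a)) + 1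
  have hab : 0 ≤ b - a := sub_nonneg.2 (ht₀.1.trans ht₀.2)
  have hR : 0 < R := by positivity
  let π : V → V := fun p => (R / max R ‖p‖) • p
  have hπn : ∀ p, ‖π p‖ = (R / max R ‖p‖) * ‖p‖ := fun p => by
    simp only [π]; rw [norm_smul, Real.norm_of_nonneg (by positivity)]
  have hπ1 : ∀ p, ‖π p‖ ≤ ‖p‖ := fun p => by
    rw [hπn]
    exact mul_le_of_le_one_left (norm_nonneg _)
      ((div_le_one (hR.trans_le (le_max_left _ _))).2 (le_max_left _ _))
  have hπ2 : ∀ p, ‖π p‖ ≤ R := fun p => by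
    rw [hπn, div_mul_eq_mul_div, div_le_iff₀ (hR.trans_le (le_max_left _ _))]
    exact mul_le_mul_of_nonneg_left (le_max_right _ _) hR.le
  obtain ⟨p, hp0, hp⟩ := exists_solution_of_lipschitz_of_bounded
    (v := fun t p => A t (π p) + c t) (K := K * 2) (B := K * R + C) ht₀ x₀
    (fun t ht x y => by
      rw [add_sub_add_right_eq_sub, ← map_sub, mul_assoc]
      refine ((A t).le_opNorm _).trans ?_
      exact mul_le_mul (hAb t ht) (norm_radial_sub_le hR x y) (norm_nonneg _) hK)
    (fun x => (hA.clm_apply continuousOn_const).add hc)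
    (fun t ht x => by
      refine (norm_add_le _ _).trans (add_le_add (((A t).le_opNorm _).trans ?_) (hcb t ht))
      exact mul_le_mul (hAb t ht) (hπ2 x) (norm_nonneg _) hK)
  refine ⟨p, hp0, fun t ht => ?_⟩
  have hbd := norm_le_of_norm_hasDerivWithinAt_le hK hC hp (fun t ht => by
    refine (norm_add_le _ _).trans (add_le_add (((A t).le_opNorm _).trans ?_) (hcb t ht))
    exact mul_le_mul (hAb t ht) (hπ1 _) (norm_nonneg _) hK) ht₀ ht
  have habs : |t - t₀| ≤ b - a := abs_sub_le_of_le_of_le ht.1 ht.2 ht₀.1 ht₀.2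
  have hpR : ‖p t‖ ≤ R := by
    refine hbd.trans ?_
    rw [hp0]
    have : (‖x₀‖ + C * |t - t₀|) * Real.exp (K * |t - t₀|) ≤
      (‖x₀‖ + C * (b - a)) * Real.exp (K * (b - a)) := by gcongr
    exact this.trans (by simp [R])
  have hπp : π (p t) = p t := by
    simp only [π]
    rw [max_eq_left hpR, div_self hR.ne', one_smul]
  have := hp t ht
  simp only [hπp] at this
  exact this

theorem abs_sub_le_of_hasDerivAt_uIoo {g g' : ℝ → ℝ} {a s C : ℝ}
    (hcont : ContinuousOn g (uIcc a s)) (hg : ∀ t ∈ uIoo a s, HasDerivAt g (g' t) t)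
    (hb : ∀ t ∈ uIoo a s, |g' t| ≤ C) : |g s - g a| ≤ C * |s - a| := by
  rcases lt_trichotomy a s with h | rfl | h
  · rw [uIcc_of_le h.le] at hcont
    rw [uIoo_of_le h.le] at hg hb
    obtain ⟨c, hc, e⟩ := exists_hasDerivAt_eq_slope g g' h hcont hg
    rw [eq_div_iff (sub_ne_zero.2 h.ne')] at e
    rw [← e, abs_mul]
    exact mul_le_mul_of_nonneg_right (hb c hc) (abs_nonneg _)
  · simp
  · rw [uIcc_of_ge h.le] at hcont
    rw [uIoo_of_ge h.le] at hg hb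
    obtain ⟨c, hc, e⟩ := exists_hasDerivAt_eq_slope g g' h hcont hg
    rw [eq_div_iff (sub_ne_zero.2 h.ne')] at e
    rw [abs_sub_comm, ← e, abs_mul, abs_sub_comm s a]
    exact mul_le_mul_of_nonneg_right (hb c hc) (abs_nonneg _)

end ODE

section Regularity

open Filter Topology

theorem continuousOn_comp_of_lipschitz {V W : Type*} [SeminormedAddCommGroup V]
    [SeminormedAddCommGroup W] {S : Set ℝ} {G : ℝ → V → W} {X : ℝ → V} {M : ℝ}
    (hG : ∀ y, ContinuousOn (G · y) S) (hlip : ∀ t ∈ S, ∀ x y, ‖G t x - G t y‖ ≤ M * ‖x - y‖)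
    (hX : ContinuousOn X S) : ContinuousOn (fun t => G t (X t)) S := by
  intro r hr
  have h1 : Tendsto (fun t => G t (X t) - G t (X r)) (𝓝[S] r) (𝓝 0) := by
    refine squeeze_zero_norm' (a := fun t => M * ‖X t - X r‖) ?_ ?_
    · filter_upwards [self_mem_nhdsWithin] with t ht using hlip t ht _ _
    · have : Tendsto (fun t => X t - X r) (𝓝[S] r) (𝓝 0) := by
        simpa using (hX r hr).sub_const (X r)
      simpa using this.norm.const_mul M
  have h2 := h1.add (hG (X r) r hr)
  simpa [ContinuousWithinAt] using h2

variable {V W : Type*} [NormedAddCommGroup V] [NormedSpace ℝ V]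
  [NormedAddCommGroup W] [NormedSpace ℝ W]

/-- Derivatives of a time-continuous family with uniform second order Taylor bounds are
continuous in time. -/
theorem continuousOn_deriv_of_taylor [FiniteDimensional ℝ V] {S : Set ℝ} {g : ℝ → V → W}
    {D : ℝ → V →L[ℝ] W} {C : ℝ} {x : V}
    (hT : ∀ t ∈ S, ∀ h, ‖g t (x + h) - g t x - D t h‖ ≤ C * ‖h‖ ^ 2)
    (hg : ∀ y, ContinuousOn (g · y) S) : ContinuousOn D S := by
  rw [continuousOn_clm_apply]
  intro h
  refine continuousOn_of_uniform_approx_of_continuousOn fun U hU => ?_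
  obtain ⟨ε, hε, hU⟩ := Metric.mem_uniformity_dist.1 hU
  set M := |C| * ‖h‖ ^ 2 + 1
  have hM : 0 < M := by positivity
  set δ := ε / M
  have hδ : 0 < δ := by positivity
  refine ⟨fun t => δ⁻¹ • (g t (x + δ • h) - g t x),
    ((hg _).sub (hg _)).const_smul _, fun t ht => hU ?_⟩
  have h1 := hT t ht (δ • h)
  rw [dist_comm, dist_eq_norm]
  have h2 : δ⁻¹ • (g t (x + δ • h) - g t x) - D t h
      = δ⁻¹ • (g t (x + δ • h) - g t x - D t (δ • h)) := by
    rw [smul_sub δ⁻¹ (_ - _) (D t (δ • h)), map_smul, smul_smul, inv_mul_cancel₀ hδ.ne', one_smul]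
  rw [h2, norm_smul, norm_inv, Real.norm_of_nonneg hδ.le, inv_mul_lt_iff₀ hδ]
  refine h1.trans_lt ?_
  rw [norm_smul, Real.norm_of_nonneg hδ.le]
  have h3 : C * ‖h‖ ^ 2 < M :=
    (mul_le_mul_of_nonneg_right (le_abs_self C) (by positivity)).trans_lt (lt_add_one _)
  have h4 : δ * M = ε := div_mul_cancel₀ _ hM.ne'
  calc C * (δ * ‖h‖) ^ 2 = δ * (δ * (C * ‖h‖ ^ 2)) := by ring
    _ < δ * (δ * M) := by gcongr
    _ = δ * ε := by rw [h4]

theorem taylor_of_lipschitz_deriv {g : V → W} {D : V → V →L[ℝ] W} {L : ℝ} (hL : 0 ≤ L)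
    (hg : ∀ x, HasFDerivAt g (D x) x) (hD : ∀ x y, ‖D x - D y‖ ≤ L * ‖x - y‖) (x h : V) :
    ‖g (x + h) - g x - D x h‖ ≤ L * ‖h‖ ^ 2 := by
  have key := (convex_closedBall x ‖h‖).norm_image_sub_le_of_norm_hasFDerivWithin_le'
    (f := g) (f' := D) (φ := D x) (C := L * ‖h‖) (y := x + h)
    (fun y _ => (hg y).hasFDerivWithinAt)
    (fun y hy => (hD y x).trans (mul_le_mul_of_nonneg_left
      (by simpa [dist_eq_norm] using hy) hL))
    (Metric.mem_closedBall_self (norm_nonneg _)) (by simp)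
  rw [add_sub_cancel_left] at key
  exact key.trans_eq (by ring)

theorem norm_sub_le_of_norm_deriv_le {g : V → W} {D : V → V →L[ℝ] W} {L : ℝ}
    (hg : ∀ x, HasFDerivAt g (D x) x) (hD : ∀ x, ‖D x‖ ≤ L) (x y : V) :
    ‖g x - g y‖ ≤ L * ‖x - y‖ :=
  convex_univ.norm_image_sub_le_of_norm_hasFDerivWithin_le
    (fun z _ => (hg z).hasFDerivWithinAt) (fun z _ => hD z) (mem_univ y) (mem_univ x)

theorem hasFDerivAt_of_taylor {g : V → W} {D : V →L[ℝ] W} {C : ℝ} {x : V}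
    (h : ∀ h, ‖g (x + h) - g x - D h‖ ≤ C * ‖h‖ ^ 2) : HasFDerivAt g D x := by
  rw [hasFDerivAt_iff_isLittleO_nhds_zero]
  refine (Asymptotics.IsBigO.of_bound C (g := fun h : V => ‖h‖ ^ 2)
    (Eventually.of_forall fun k => by simpa using h k)).trans_isLittleO ?_
  simpa using Asymptotics.isLittleO_norm_pow_id (E' := V) one_lt_two

/-- `g` is `N`-Lipschitz and satisfies the first order Taylor estimate with derivative `D` and
constant `N`. -/
def TaylorBound (g : V → ℝ) (D : V → V →L[ℝ] ℝ) (N : ℝ) : Prop :=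
  (∀ x y, |g x - g y| ≤ N * ‖x - y‖) ∧ ∀ x h, |g (x + h) - g x - D x h| ≤ N * ‖h‖ ^ 2

/-- A derivative-free substitute for `TaylorBound`, stable under pointwise limits. -/
def ChordBound (g : V → ℝ) (N : ℝ) : Prop :=
  (∀ x y, |g x - g y| ≤ N * ‖x - y‖) ∧
    ∀ x h, ∀ σ ∈ Icc (0 : ℝ) 1,
      |g (x + σ • h) - g x - σ * (g (x + h) - g x)| ≤ N * σ * ‖h‖ ^ 2

theorem TaylorBound.mono {g : V → ℝ} {D : V → V →L[ℝ] ℝ} {N N' : ℝ} (h : TaylorBound g D N)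
    (hN : N ≤ N') : TaylorBound g D N' :=
  ⟨fun x y => (h.1 x y).trans (by gcongr), fun x k => (h.2 x k).trans (by gcongr)⟩

theorem TaylorBound.chordBound {g : V → ℝ} {D : V → V →L[ℝ] ℝ} {N : ℝ} (hN : 0 ≤ N)
    (h : TaylorBound g D N) : ChordBound g (2 * N) := by
  refine ⟨fun x y => (h.1 x y).trans ?_, fun x k σ hσ => ?_⟩
  · gcongr; linarith
  · have h1 := h.2 x (σ • k)
    have h2 := h.2 x k
    rw [map_smul, smul_eq_mul, norm_smul, Real.norm_of_nonneg hσ.1] at h1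
    have h3 : g (x + σ • k) - g x - σ * (g (x + k) - g x) =
      (g (x + σ • k) - g x - σ * D x k) - σ * (g (x + k) - g x - D x k) := by ring
    rw [h3]
    refine (abs_sub _ _).trans ?_
    rw [abs_mul, abs_of_nonneg hσ.1]
    have h4 : σ * |g (x + k) - g x - D x k| ≤ σ * (N * ‖k‖ ^ 2) :=
      mul_le_mul_of_nonneg_left h2 hσ.1
    have h5 : N * (σ * ‖k‖) ^ 2 ≤ N * σ * ‖k‖ ^ 2 := by
      have : σ * σ ≤ σ * 1 := mul_le_mul_of_nonneg_left hσ.2 hσ.1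
      calc N * (σ * ‖k‖) ^ 2 = N * ‖k‖ ^ 2 * (σ * σ) := by ring
        _ ≤ N * ‖k‖ ^ 2 * (σ * 1) := by gcongr
        _ = _ := by ring
    linarith

theorem ChordBound.taylorBound {g : V → ℝ} {D : V → V →L[ℝ] ℝ} {N : ℝ}
    (hg : ∀ x, HasFDerivAt g (D x) x) (h : ChordBound g N) : TaylorBound g D N := by
  refine ⟨h.1, fun x k => ?_⟩
  have hlim : Tendsto (fun σ : ℝ => |g (x + k) - g x - σ⁻¹ * (g (x + σ • k) - g x)|)
      (𝓝[>] 0) (𝓝 |g (x + k) - g x - D x k|) := by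
    have h1 := (hg x).hasLineDerivAt k
    have h2 := (hasDerivAt_iff_tendsto_slope_zero.1 h1).mono_left
      (nhdsWithin_mono 0 (fun σ (hσ : 0 < σ) => hσ.ne') : 𝓝[>] (0 : ℝ) ≤ 𝓝[≠] 0)
    simp only [zero_add, zero_smul, add_zero, smul_eq_mul] at h2
    exact (h2.const_sub _).abs
  refine le_of_tendsto hlim ?_
  filter_upwards [Ioc_mem_nhdsGT (zero_lt_one' ℝ)] with σ hσ
  have h1 := h.2 x k σ ⟨hσ.1.le, hσ.2⟩
  have h2 : g (x + k) - g x - σ⁻¹ * (g (x + σ • k) - g x) =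
      -(σ⁻¹ * (g (x + σ • k) - g x - σ * (g (x + k) - g x))) := by
    have := hσ.1.ne'
    field_simp
    ring
  rw [h2, abs_neg, abs_mul, abs_of_pos (inv_pos.2 hσ.1), inv_mul_le_iff₀ hσ.1]
  exact h1.trans_eq (by ring)

theorem isClosed_chordBound {u : ℝ → V → ℝ} {S : Set ℝ} (hS : IsClosed S)
    (hu : ∀ x, ContinuousOn (u · x) S) (N : ℝ) : IsClosed {t ∈ S | ChordBound (u t) N} := by
  have h1 : {t ∈ S | ChordBound (u t) N} =
      (⋂ x, ⋂ y, {t ∈ S | |u t x - u t y| ≤ N * ‖x - y‖}) ∩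
      ⋂ x, ⋂ h, ⋂ σ : Icc (0 : ℝ) 1, {t ∈ S |
        |u t (x + (σ : ℝ) • h) - u t x - σ * (u t (x + h) - u t x)| ≤ N * σ * ‖h‖ ^ 2} := by
    ext t
    simp only [ChordBound, mem_ofPred_eq, mem_inter_iff, mem_iInter, Subtype.forall]
    refine ⟨fun h => ⟨fun x y => ⟨h.1, h.2.1 x y⟩, fun x k σ hσ => ⟨h.1, h.2.2 x k σ hσ⟩⟩,
      fun h => ⟨(h.1 0 0).1, fun x y => (h.1 x y).2, fun x k σ hσ => (h.2 x k σ hσ).2⟩⟩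
  rw [h1]
  refine IsClosed.inter ?_ ?_
  · exact isClosed_iInter fun x => isClosed_iInter fun y =>
      hS.isClosed_le ((hu x).sub (hu y)).abs continuousOn_const
  · refine isClosed_iInter fun x => isClosed_iInter fun k => isClosed_iInter fun σ =>
      hS.isClosed_le ?_ continuousOn_const
    exact (((hu _).sub (hu _)).sub (continuousOn_const.mul ((hu _).sub (hu _)))).abs

end Regularity

section Transport

open Filter Topology

variable {V : Type*} [NormedAddCommGroup V] [NormedSpace ℝ V]

/-- On `[0,T]`, `u` solves `∂ₜu + Du·f + q = 0` classically, `f` is bounded by `B`, and the first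
derivatives of `f` and `q` are bounded by `L` and `L`-Lipschitz. No joint regularity of `u` is
assumed. -/
structure IsTransportSolution (T L B : ℝ) (f : ℝ → V → V) (Df : ℝ → V → V →L[ℝ] V)
    (q : ℝ → V → ℝ) (Dq : ℝ → V → V →L[ℝ] ℝ) (u : ℝ → V → ℝ)
    (Du : ℝ → V → V →L[ℝ] ℝ) : Prop where
  T_nonneg : 0 ≤ T
  L_nonneg : 0 ≤ L
  f_cont : ∀ x, ContinuousOn (f · x) (Icc 0 T)
  f_deriv : ∀ t ∈ Icc 0 T, ∀ x, HasFDerivAt (f t) (Df t x) x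
  f_le : ∀ t ∈ Icc 0 T, ∀ x, ‖f t x‖ ≤ B
  Df_le : ∀ t ∈ Icc 0 T, ∀ x, ‖Df t x‖ ≤ L
  Df_lip : ∀ t ∈ Icc 0 T, ∀ x y, ‖Df t x - Df t y‖ ≤ L * ‖x - y‖
  q_cont : ∀ x, ContinuousOn (q · x) (Icc 0 T)
  q_deriv : ∀ t ∈ Icc 0 T, ∀ x, HasFDerivAt (q t) (Dq t x) x
  Dq_le : ∀ t ∈ Icc 0 T, ∀ x, ‖Dq t x‖ ≤ L
  Dq_lip : ∀ t ∈ Icc 0 T, ∀ x y, ‖Dq t x - Dq t y‖ ≤ L * ‖x - y‖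
  u_deriv : ∀ t ∈ Icc 0 T, ∀ x, HasFDerivAt (u t) (Du t x) x
  u_time : ∀ t ∈ Icc 0 T, ∀ x,
    HasDerivWithinAt (u · x) (-(Du t x (f t x)) - q t x) (Icc 0 T) t
  u_reg : ∀ t ∈ Icc 0 T, ∃ N, 0 ≤ N ∧ TaylorBound (u t) (Du t) N

/-- `X` is a characteristic of `f` on `[0,T]`. -/
def IsCharacteristic (T : ℝ) (f : ℝ → V → V) (X : ℝ → V) : Prop :=
  ∀ s ∈ Icc 0 T, HasDerivWithinAt X (f s (X s)) (Icc 0 T) s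

/-- `u` has locally uniform `TaylorBound`s near the time `r`. -/
def IsTameAt (T : ℝ) (u : ℝ → V → ℝ) (Du : ℝ → V → V →L[ℝ] ℝ) (r : ℝ) : Prop :=
  ∃ N, ∀ᶠ s in 𝓝[Icc 0 T] r, TaylorBound (u s) (Du s) N

namespace IsTransportSolution

variable {T L B : ℝ} {f : ℝ → V → V} {Df : ℝ → V → V →L[ℝ] V}
  {q : ℝ → V → ℝ} {Dq : ℝ → V → V →L[ℝ] ℝ} {u : ℝ → V → ℝ} {Du : ℝ → V → V →L[ℝ] ℝ}

theorem u_cont (H : IsTransportSolution T L B f Df q Dq u Du) (x : V) :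
    ContinuousOn (u · x) (Icc 0 T) :=
  fun t ht => (H.u_time t ht x).continuousWithinAt

theorem f_lip (H : IsTransportSolution T L B f Df q Dq u Du) {t : ℝ} (ht : t ∈ Icc 0 T)
    (x y : V) : ‖f t x - f t y‖ ≤ L * ‖x - y‖ :=
  norm_sub_le_of_norm_deriv_le (H.f_deriv t ht) (H.Df_le t ht) x y

theorem q_lip (H : IsTransportSolution T L B f Df q Dq u Du) {t : ℝ} (ht : t ∈ Icc 0 T)
    (x y : V) : |q t x - q t y| ≤ L * ‖x - y‖ :=
  norm_sub_le_of_norm_deriv_le (H.q_deriv t ht) (H.Dq_le t ht) x y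

theorem exists_characteristic [CompleteSpace V] (H : IsTransportSolution T L B f Df q Dq u Du)
    {s : ℝ} (hs : s ∈ Icc 0 T) (x : V) : ∃ X, IsCharacteristic T f X ∧ X s = x := by
  obtain ⟨X, h0, h1⟩ := exists_solution_of_lipschitz_of_bounded hs x
    (fun t ht => H.f_lip ht) H.f_cont H.f_le
  exact ⟨X, h1, h0⟩

theorem norm_characteristic_sub_le (H : IsTransportSolution T L B f Df q Dq u Du) {X Y : ℝ → V}
    (hX : IsCharacteristic T f X) (hY : IsCharacteristic T f Y) {s t : ℝ}
    (hs : s ∈ Icc 0 T) (ht : t ∈ Icc 0 T) :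
    ‖X s - Y s‖ ≤ Real.exp (L * |s - t|) * ‖X t - Y t‖ := by
  have key := norm_le_of_norm_hasDerivWithinAt_le (g := fun r => X r - Y r) (ε := 0)
    H.L_nonneg le_rfl (fun r hr => (hX r hr).sub (hY r hr))
    (fun r hr => (H.f_lip hr _ _).trans_eq (add_zero _).symm) ht hs
  exact key.trans_eq (by ring)

theorem abs_sub_le_T {s t : ℝ} (hs : s ∈ Icc 0 T) (ht : t ∈ Icc 0 T) : |s - t| ≤ T := by
  simpa using abs_sub_le_of_le_of_le hs.1 hs.2 ht.1 ht.2

theorem norm_characteristic_sub_le' (H : IsTransportSolution T L B f Df q Dq u Du) {X Y : ℝ → V}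
    (hX : IsCharacteristic T f X) (hY : IsCharacteristic T f Y) {s t : ℝ}
    (hs : s ∈ Icc 0 T) (ht : t ∈ Icc 0 T) :
    ‖X s - Y s‖ ≤ Real.exp (L * T) * ‖X t - Y t‖ := by
  refine (H.norm_characteristic_sub_le hX hY hs ht).trans ?_
  have := H.L_nonneg
  have := abs_sub_le_T hs ht
  gcongr

/-- Transport along characteristics at tame times. -/
theorem hasDerivWithinAt_comp_characteristic [FiniteDimensional ℝ V]
    (H : IsTransportSolution T L B f Df q Dq u Du) {X : ℝ → V} (hX : IsCharacteristic T f X)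
    {r : ℝ} (hr : r ∈ Icc 0 T) (htame : IsTameAt T u Du r) :
    HasDerivWithinAt (fun t => u t (X t)) (-q r (X r)) (Icc 0 T) r := by
  obtain ⟨N, hN⟩ := htame
  set S := {s ∈ Icc 0 T | TaylorBound (u s) (Du s) N}
  have hS : S ∈ 𝓝[Icc 0 T] r := by
    filter_upwards [hN, self_mem_nhdsWithin] with s h1 h2 using ⟨h2, h1⟩
  have hSI : S ⊆ Icc 0 T := fun s hs => hs.1
  have hrS : r ∈ S := mem_of_mem_nhdsWithin hr hS
  refine HasDerivWithinAt.mono_of_mem_nhdsWithin (t := S) ?_ hS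
  have hXS : HasDerivWithinAt X (f r (X r)) S r := (hX r hr).mono hSI
  have hD : ContinuousOn (fun t => Du t (X r)) S :=
    continuousOn_deriv_of_taylor (fun t ht => ht.2.2 (X r)) (fun y => (H.u_cont y).mono hSI)
  have h1 : HasDerivWithinAt (fun t => u t (X t) - u t (X r) - Du t (X r) (X t - X r)) 0 S r := by
    rw [hasDerivWithinAt_iff_isLittleO]
    have hO : (fun t => X t - X r) =O[𝓝[S] r] fun t => t - r :=
      hXS.hasFDerivWithinAt.isBigO_sub
    have ho : (fun t => ‖X t - X r‖ ^ 2) =o[𝓝[S] r] fun t => t - r := by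
      refine (hO.norm_left.pow 2).trans_isLittleO ?_
      have h0 : Tendsto (fun t => t - r) (𝓝[S] r) (𝓝 0) := by
        have : Tendsto (fun t : ℝ => t - r) (𝓝 r) (𝓝 (r - r)) :=
          (continuous_id.sub continuous_const).tendsto r
        rw [sub_self] at this
        exact this.mono_left nhdsWithin_le_nhds
      exact (Asymptotics.isLittleO_pow_id one_lt_two).comp_tendsto h0
    refine (Asymptotics.IsBigO.of_bound N ?_).trans_isLittleO ho
    filter_upwards [self_mem_nhdsWithin] with t ht
    have := ht.2.2 (X r) (X t - X r)
    simpa using this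
  have h2 : HasDerivWithinAt (fun t => Du t (X r) (X t - X r)) (Du r (X r) (f r (X r))) S r := by
    rw [hasDerivWithinAt_iff_tendsto_slope]
    have hs := hasDerivWithinAt_iff_tendsto_slope.1 hXS
    have hD' : Tendsto (fun t => Du t (X r)) (𝓝[S \ {r}] r) (𝓝 (Du r (X r))) :=
      (hD r hrS).mono_left (nhdsWithin_mono _ sdiff_subset)
    refine ((isBoundedBilinearMap_apply.continuous.tendsto (Du r (X r), f r (X r))).comp
      (hD'.prodMk_nhds hs)).congr fun t => ?_
    simp [slope_def_module]
  have h3 := (H.u_time r hr (X r)).mono hSI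
  have h4 := (h1.add h2).add h3
  refine (h4.congr_deriv ?_).congr ?_ ?_
  · ring
  · intro t _; simp
  · simp

theorem hasDerivAt_comp_characteristic [FiniteDimensional ℝ V]
    (H : IsTransportSolution T L B f Df q Dq u Du) {X : ℝ → V} (hX : IsCharacteristic T f X)
    {r a s : ℝ} (ha : a ∈ Icc 0 T) (hs : s ∈ Icc 0 T) (hr : r ∈ uIoo a s)
    (htame : IsTameAt T u Du r) :
    HasDerivAt (fun t => u t (X t)) (-q r (X r)) r :=
  (H.hasDerivWithinAt_comp_characteristic hX (uIcc_subset_Icc ha hs (uIoo_subset_uIcc_self hr))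
    htame).hasDerivAt
    (Icc_mem_nhds ((le_min ha.1 hs.1).trans_lt hr.1) (hr.2.trans_le (max_le ha.2 hs.2)))

/-- Spatial Lipschitz bounds are propagated along intervals of tame times. -/
theorem exists_lipschitz_of_isTameAt [FiniteDimensional ℝ V]
    (H : IsTransportSolution T L B f Df q Dq u Du)
    {a s : ℝ} (ha : a ∈ Icc 0 T) (hs : s ∈ Icc 0 T)
    (htame : ∀ r ∈ uIcc a s, r ≠ a → IsTameAt T u Du r) :
    ∃ M, ∀ t ∈ uIcc a s, ∀ x y, |u t x - u t y| ≤ M * ‖x - y‖ := by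
  obtain ⟨N, hN0, hN⟩ := H.u_reg s hs
  obtain ⟨N', -, hN'⟩ := H.u_reg a ha
  have : CompleteSpace V := FiniteDimensional.complete ℝ V
  refine ⟨max N' ((N + L * T) * Real.exp (L * T)), fun t ht x y => ?_⟩
  rcases eq_or_ne t a with rfl | hta
  · refine (hN'.1 x y).trans ?_
    gcongr
    exact le_max_left _ _
  have hsub : uIcc t s ⊆ uIcc a s := uIcc_subset_uIcc_right ht
  have hat : a ∉ uIcc t s := fun h => hta (by
    rcases le_total a s with h' | h'
    · rw [uIcc_of_le h'] at ht
      rw [uIcc_of_le ht.2] at h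
      exact le_antisymm h.1 ht.1
    · rw [uIcc_of_ge h'] at ht
      rw [uIcc_of_ge ht.1] at h
      exact le_antisymm ht.2 h.2)
  have htI : t ∈ Icc 0 T := uIcc_subset_Icc ha hs ht
  have htame' : ∀ r ∈ uIcc t s, IsTameAt T u Du r := fun r hr =>
    htame r (hsub hr) fun e => hat (e ▸ hr)
  obtain ⟨X, hX, rfl⟩ := H.exists_characteristic htI x
  obtain ⟨Y, hY, rfl⟩ := H.exists_characteristic htI y
  have hL := H.L_nonneg
  have key := abs_sub_le_of_hasDerivAt_uIoo (a := s) (s := t)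
    (g := fun r => u r (X r) - u r (Y r)) (g' := fun r => -q r (X r) - -q r (Y r))
    (C := L * (Real.exp (L * T) * ‖X t - Y t‖))
    (by
      rw [uIcc_comm]
      intro r hr
      have hrI := uIcc_subset_Icc htI hs hr
      exact (((H.hasDerivWithinAt_comp_characteristic hX hrI (htame' r hr)).sub
        (H.hasDerivWithinAt_comp_characteristic hY hrI (htame' r hr))).continuousWithinAt).mono
        (uIcc_subset_Icc htI hs))
    (fun r hr => by
      have hr' : r ∈ uIcc t s := uIcc_comm s t ▸ uIoo_subset_uIcc_self hr
      exact (H.hasDerivAt_comp_characteristic hX hs htI hr (htame' r hr')).sub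
        (H.hasDerivAt_comp_characteristic hY hs htI hr (htame' r hr')))
    (fun r hr => by
      have hrI : r ∈ Icc 0 T := uIcc_subset_Icc hs htI (uIoo_subset_uIcc_self hr)
      rw [← neg_add', abs_neg, ← sub_eq_add_neg]
      refine (H.q_lip hrI _ _).trans ?_
      gcongr
      exact H.norm_characteristic_sub_le' hX hY hrI htI)
  have h1 := hN.1 (X s) (Y s)
  have h2 : N * ‖X s - Y s‖ ≤ N * (Real.exp (L * T) * ‖X t - Y t‖) := by
    gcongr
    exact H.norm_characteristic_sub_le' hX hY hs htI
  have h3 : L * (Real.exp (L * T) * ‖X t - Y t‖) * |t - s| ≤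
      L * (Real.exp (L * T) * ‖X t - Y t‖) * T := by
    gcongr
    exact abs_sub_le_T htI hs
  have h4 := abs_sub_abs_le_abs_sub (u t (X t) - u t (Y t)) (u s (X s) - u s (Y s))
  calc |u t (X t) - u t (Y t)| ≤ (N + L * T) * Real.exp (L * T) * ‖X t - Y t‖ := by
        nlinarith
    _ ≤ _ := by gcongr; exact le_max_right _ _

theorem continuousOn_comp_characteristic [FiniteDimensional ℝ V]
    (H : IsTransportSolution T L B f Df q Dq u Du) {X : ℝ → V} (hX : IsCharacteristic T f X)
    {a s : ℝ} (ha : a ∈ Icc 0 T) (hs : s ∈ Icc 0 T)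
    (htame : ∀ r ∈ uIcc a s, r ≠ a → IsTameAt T u Du r) :
    ContinuousOn (fun t => u t (X t)) (uIcc a s) := by
  obtain ⟨M, hM⟩ := H.exists_lipschitz_of_isTameAt ha hs htame
  have hsub := uIcc_subset_Icc ha hs
  exact continuousOn_comp_of_lipschitz (fun y => (H.u_cont y).mono hsub) hM
    fun t ht => ((hX t (hsub ht)).continuousWithinAt).mono hsub

/-- `p` solves the equation satisfied by the derivative of `u` along the characteristic `X`. -/
def IsAdjoint (T : ℝ) (Df : ℝ → V → V →L[ℝ] V) (Dq : ℝ → V → V →L[ℝ] ℝ) (X : ℝ → V)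
    (p : ℝ → V →L[ℝ] ℝ) : Prop :=
  ∀ t ∈ Icc 0 T,
    HasDerivWithinAt p (-((p t).comp (Df t (X t))) - Dq t (X t)) (Icc 0 T) t

theorem exists_isAdjoint [FiniteDimensional ℝ V]
    (H : IsTransportSolution T L B f Df q Dq u Du) {X : ℝ → V} (hX : IsCharacteristic T f X)
    {a : ℝ} (ha : a ∈ Icc 0 T) (p₀ : V →L[ℝ] ℝ) :
    ∃ p, IsAdjoint T Df Dq X p ∧ p a = p₀ := by
  have hXc : ContinuousOn X (Icc 0 T) := fun t ht => (hX t ht).continuousWithinAt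
  have hDf : ContinuousOn (fun t => Df t (X t)) (Icc 0 T) :=
    continuousOn_comp_of_lipschitz (fun y => continuousOn_deriv_of_taylor (fun t ht =>
      taylor_of_lipschitz_deriv H.L_nonneg (H.f_deriv t ht) (H.Df_lip t ht) y) H.f_cont)
      H.Df_lip hXc
  have hDq : ContinuousOn (fun t => Dq t (X t)) (Icc 0 T) :=
    continuousOn_comp_of_lipschitz (fun y => continuousOn_deriv_of_taylor (fun t ht =>
      taylor_of_lipschitz_deriv H.L_nonneg (H.q_deriv t ht) (H.Dq_lip t ht) y) H.q_cont)
      H.Dq_lip hXc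
  obtain ⟨p, hp0, hp⟩ := exists_solution_linear
    (A := fun t => -((ContinuousLinearMap.compL ℝ V V ℝ).flip (Df t (X t))))
    (c := fun t => -Dq t (X t)) (K := L) (C := L) ha p₀ H.L_nonneg H.L_nonneg
    (((ContinuousLinearMap.compL ℝ V V ℝ).flip.continuous.comp_continuousOn hDf).neg) hDq.neg
    (fun t ht => by
      rw [norm_neg]
      refine ContinuousLinearMap.opNorm_le_bound _ H.L_nonneg fun g => ?_
      simp only [ContinuousLinearMap.flip_apply, ContinuousLinearMap.compL_apply]
      refine (ContinuousLinearMap.opNorm_comp_le _ _).trans ?_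
      rw [mul_comm]
      gcongr
      exact H.Df_le t ht _)
    (fun t ht => by rw [norm_neg]; exact H.Dq_le t ht _)
  refine ⟨p, fun t ht => (hp t ht).congr_deriv ?_, hp0⟩
  simp [sub_eq_add_neg]

theorem norm_isAdjoint_le (H : IsTransportSolution T L B f Df q Dq u Du) {X : ℝ → V}
    {p : ℝ → V →L[ℝ] ℝ} (hp : IsAdjoint T Df Dq X p) {s t : ℝ}
    (ht : t ∈ Icc 0 T) (hs : s ∈ Icc 0 T) :
    ‖p s‖ ≤ (‖p t‖ + L * |s - t|) * Real.exp (L * |s - t|) := by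
  refine norm_le_of_norm_hasDerivWithinAt_le H.L_nonneg H.L_nonneg hp (fun r hr => ?_) ht hs
  refine (norm_sub_le _ _).trans (add_le_add ?_ (H.Dq_le r hr _))
  rw [norm_neg, mul_comm]
  refine (ContinuousLinearMap.opNorm_comp_le _ _).trans ?_
  gcongr
  exact H.Df_le r hr _

/-- First order Taylor expansions are propagated along characteristics, with derivative given by
the adjoint equation. -/
theorem taylor_propagate [FiniteDimensional ℝ V]
    (H : IsTransportSolution T L B f Df q Dq u Du)
    {a s N P : ℝ} (ha : a ∈ Icc 0 T) (hs : s ∈ Icc 0 T)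
    (htame : ∀ r ∈ uIcc a s, r ≠ a → IsTameAt T u Du r)
    (hN : 0 ≤ N) (hreg : TaylorBound (u a) (Du a) N)
    {X : ℝ → V} (hX : IsCharacteristic T f X)
    {p : ℝ → V →L[ℝ] ℝ} (hp : IsAdjoint T Df Dq X p) (hpa : p a = Du a (X a))
    (hP : ∀ t ∈ Icc 0 T, ‖p t‖ ≤ P) (h : V) :
    |u s (X s + h) - u s (X s) - p s h| ≤
      (N + (L + P * L) * T) * Real.exp (L * T) ^ 2 * ‖h‖ ^ 2 := by
  have : CompleteSpace V := FiniteDimensional.complete ℝ V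
  obtain ⟨Y, hY, hYs⟩ := H.exists_characteristic hs (X s + h)
  have hL := H.L_nonneg
  have hP0 : 0 ≤ P := (norm_nonneg _).trans (hP a ha)
  set G := Real.exp (L * T) * ‖h‖
  have hYX : ∀ r ∈ Icc 0 T, ‖Y r - X r‖ ≤ G := fun r hr => by
    have := H.norm_characteristic_sub_le' hY hX hr hs
    rwa [hYs, add_sub_cancel_left] at this
  have hsub := uIcc_subset_Icc ha hs
  have key := abs_sub_le_of_hasDerivAt_uIoo (a := a) (s := s)
    (g := fun r => u r (Y r) - u r (X r) - p r (Y r - X r))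
    (g' := fun r => -q r (Y r) - -q r (X r) -
      ((-((p r).comp (Df r (X r))) - Dq r (X r)) (Y r - X r) +
        p r (f r (Y r) - f r (X r))))
    (C := (L + P * L) * G ^ 2)
    (((H.continuousOn_comp_characteristic hY ha hs htame).sub
      (H.continuousOn_comp_characteristic hX ha hs htame)).sub
      (ContinuousOn.clm_apply
        (fun t ht => ((hp t (hsub ht)).continuousWithinAt).mono hsub)
        (fun t ht => (((hY t (hsub ht)).sub (hX t (hsub ht))).continuousWithinAt).mono hsub)))
    (fun r hr => by
      have hr' := uIoo_subset_uIcc_self hr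
      have hra : r ≠ a := by
        rintro rfl
        rcases le_total r s with h' | h'
        · rw [uIoo_of_le h'] at hr; exact lt_irrefl _ hr.1
        · rw [uIoo_of_ge h'] at hr; exact lt_irrefl _ hr.2
      have hnhds : Icc 0 T ∈ 𝓝 r :=
        Icc_mem_nhds ((le_min ha.1 hs.1).trans_lt hr.1) (hr.2.trans_le (max_le ha.2 hs.2))
      exact ((H.hasDerivAt_comp_characteristic hY ha hs hr (htame r hr' hra)).sub
        (H.hasDerivAt_comp_characteristic hX ha hs hr (htame r hr' hra))).sub
        (((hp r (hsub hr')).hasDerivAt hnhds).clm_apply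
          (((hY r (hsub hr')).sub (hX r (hsub hr'))).hasDerivAt hnhds)))
    (fun r hr => by
      have hrI := hsub (uIoo_subset_uIcc_self hr)
      have e1 := taylor_of_lipschitz_deriv hL (H.q_deriv r hrI) (H.Dq_lip r hrI)
        (X r) (Y r - X r)
      have e2 := taylor_of_lipschitz_deriv hL (H.f_deriv r hrI) (H.Df_lip r hrI)
        (X r) (Y r - X r)
      rw [add_sub_cancel] at e1 e2
      have e3 : ‖Y r - X r‖ ^ 2 ≤ G ^ 2 := by gcongr; exact hYX r hrI
      have e4 : |p r (f r (Y r) - f r (X r) - Df r (X r) (Y r - X r))| ≤ P * (L * G ^ 2) := by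
        refine ((p r).le_opNorm _).trans (mul_le_mul (hP r hrI) (e2.trans ?_) (norm_nonneg _) hP0)
        gcongr
      have e5 : |q r (Y r) - q r (X r) - Dq r (X r) (Y r - X r)| ≤ L * G ^ 2 :=
        e1.trans (by gcongr)
      have e6 : -q r (Y r) - -q r (X r) -
          ((-((p r).comp (Df r (X r))) - Dq r (X r)) (Y r - X r) +
            p r (f r (Y r) - f r (X r))) =
          -(q r (Y r) - q r (X r) - Dq r (X r) (Y r - X r)) -
            p r (f r (Y r) - f r (X r) - Df r (X r) (Y r - X r)) := by
        simp
        ring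
      rw [e6]
      refine (abs_sub _ _).trans ?_
      rw [abs_neg]
      linarith)
  have h1 := hreg.2 (X a) (Y a - X a)
  rw [add_sub_cancel] at h1
  have h2 : N * ‖Y a - X a‖ ^ 2 ≤ N * G ^ 2 := by gcongr; exact hYX a ha
  have h3 : (L + P * L) * G ^ 2 * |s - a| ≤ (L + P * L) * G ^ 2 * T := by
    gcongr
    exact abs_sub_le_T hs ha
  rw [hYs, add_sub_cancel_left, hpa] at key
  have h4 := abs_sub_abs_le_abs_sub (u s (X s + h) - u s (X s) - p s h)
    (u a (Y a) - u a (X a) - Du a (X a) (Y a - X a))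
  calc _ ≤ N * G ^ 2 + (L + P * L) * G ^ 2 * T := by linarith
    _ = _ := by simp only [G]; ring

theorem deriv_eq_of_isAdjoint [FiniteDimensional ℝ V]
    (H : IsTransportSolution T L B f Df q Dq u Du)
    {a s : ℝ} (ha : a ∈ Icc 0 T) (hs : s ∈ Icc 0 T)
    (htame : ∀ r ∈ uIcc a s, r ≠ a → IsTameAt T u Du r)
    {X : ℝ → V} (hX : IsCharacteristic T f X)
    {p : ℝ → V →L[ℝ] ℝ} (hp : IsAdjoint T Df Dq X p) (hpa : p a = Du a (X a)) :
    Du s (X s) = p s := by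
  obtain ⟨N, hN, hreg⟩ := H.u_reg a ha
  have hL := H.L_nonneg
  refine (H.u_deriv s hs (X s)).unique (hasFDerivAt_of_taylor
    (H.taylor_propagate ha hs htame hN hreg hX hp hpa
      (P := (‖p a‖ + L * T) * Real.exp (L * T)) fun t ht => ?_))
  have hT := H.T_nonneg
  refine (H.norm_isAdjoint_le hp ha ht).trans ?_
  have := abs_sub_le_T ht ha
  gcongr

theorem exists_taylorBound_propagate [FiniteDimensional ℝ V]
    (H : IsTransportSolution T L B f Df q Dq u Du) {N : ℝ} (hN : 0 ≤ N) :
    ∃ N', ∀ a ∈ Icc 0 T, ∀ s ∈ Icc 0 T,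
      (∀ r ∈ uIcc a s, r ≠ a → IsTameAt T u Du r) →
      TaylorBound (u a) (Du a) N → TaylorBound (u s) (Du s) N' := by
  have : CompleteSpace V := FiniteDimensional.complete ℝ V
  set P := (N + L * T) * Real.exp (L * T)
  set C := (N + (L + P * L) * T) * Real.exp (L * T) ^ 2
  refine ⟨max P C, fun a ha s hs htame hreg => ?_⟩
  have hL := H.L_nonneg
  have hT := H.T_nonneg
  have key : ∀ x, ‖Du s x‖ ≤ P ∧ ∀ h, |u s (x + h) - u s x - Du s x h| ≤ C * ‖h‖ ^ 2 := by
    intro x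
    obtain ⟨X, hX, rfl⟩ := H.exists_characteristic hs x
    obtain ⟨p, hp, hpa⟩ := H.exists_isAdjoint hX ha (Du a (X a))
    have hDa : ‖p a‖ ≤ N := by
      rw [hpa]
      exact (H.u_deriv a ha (X a)).le_of_lip' hN (Eventually.of_forall fun y => hreg.1 y _)
    have hP : ∀ t ∈ Icc 0 T, ‖p t‖ ≤ P := fun t ht => by
      refine (H.norm_isAdjoint_le hp ha ht).trans ?_
      have := abs_sub_le_T ht ha
      simp only [P]
      gcongr
    rw [H.deriv_eq_of_isAdjoint ha hs htame hX hp hpa]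
    exact ⟨hP s hs, H.taylor_propagate ha hs htame hN hreg hX hp hpa hP⟩
  refine ⟨fun x y => ?_, fun x h => ((key x).2 h).trans ?_⟩
  · exact norm_sub_le_of_norm_deriv_le (H.u_deriv s hs)
      (fun z => (key z).1.trans (le_max_left _ _)) x y
  · gcongr
    exact le_max_right _ _

/-- Every time is tame, by the Baire category theorem applied to the set of times which are
not. -/
theorem isTameAt [FiniteDimensional ℝ V]
    (H : IsTransportSolution T L B f Df q Dq u Du) {r : ℝ} (hr : r ∈ Icc 0 T) :
    IsTameAt T u Du r := by
  by_contra hnot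
  set F := {t ∈ Icc 0 T | ¬ IsTameAt T u Du t}
  have hFclosed : IsClosed F := by
    refine isClosed_of_closure_subset fun t ht => ?_
    have htI : t ∈ Icc 0 T := closure_minimal (fun s hs => hs.1) isClosed_Icc ht
    refine ⟨htI, fun ⟨N, hN⟩ => ?_⟩
    have h1 : ∀ᶠ s in 𝓝[Icc 0 T] t, IsTameAt T u Du s :=
      (eventually_eventually_nhdsWithin.2 hN).mono fun s hs => ⟨N, hs⟩
    obtain ⟨s, hsF, hs⟩ :=
      ((mem_closure_iff_frequently.1 ht).and_eventually (eventually_nhdsWithin_iff.1 h1)).exists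
    exact hsF.2 (hs hsF.1)
  have : CompleteSpace F := hFclosed.isComplete.completeSpace_coe
  have : Nonempty F := ⟨⟨r, hr, hnot⟩⟩
  obtain ⟨n, t₀, ht₀⟩ := nonempty_interior_of_iUnion_of_closed
    (f := fun n : ℕ => ((↑) : F → ℝ) ⁻¹' {t ∈ Icc 0 T | ChordBound (u t) n})
    (fun n => (isClosed_chordBound isClosed_Icc H.u_cont n).preimage continuous_subtype_val)
    (by
      refine eq_univ_of_forall fun t => mem_iUnion.2 ?_
      obtain ⟨N, hN0, hN⟩ := H.u_reg t t.2.1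
      obtain ⟨n, hn⟩ := exists_nat_ge N
      refine ⟨2 * n, t.2.1, ?_⟩
      push_cast
      exact (hN.mono hn).chordBound n.cast_nonneg)
  obtain ⟨ε, hε, hball⟩ := Metric.mem_nhds_iff.1 (mem_interior_iff_mem_nhds.1 ht₀)
  obtain ⟨N', hN'⟩ := H.exists_taylorBound_propagate (N := n) n.cast_nonneg
  refine t₀.2.2 ⟨N', ?_⟩
  filter_upwards [self_mem_nhdsWithin, mem_nhdsWithin_of_mem_nhds (Metric.ball_mem_nhds _ hε)]
    with s hs hsε
  obtain ⟨a, ⟨haF, has⟩, hamin⟩ := (isCompact_uIcc.inter_left hFclosed).exists_infDist_eq_dist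
    (s := F ∩ uIcc (t₀ : ℝ) s) ⟨t₀, t₀.2, left_mem_uIcc⟩ s
  have hsub : uIcc a s ⊆ uIcc (t₀ : ℝ) s := uIcc_subset_uIcc_right has
  refine hN' a haF.1 s hs (fun r hr hra => ?_) ?_
  · by_contra hrt
    have hrF : r ∈ F := ⟨uIcc_subset_Icc haF.1 hs hr, hrt⟩
    have h1 := Metric.infDist_le_dist_of_mem (x := s)
      (show r ∈ F ∩ uIcc (t₀ : ℝ) s from ⟨hrF, hsub hr⟩)
    rw [hamin, Real.dist_eq, Real.dist_eq] at h1
    rcases le_total a s with h | h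
    · rw [uIcc_of_le h] at hr
      rw [abs_of_nonneg (sub_nonneg.2 h), abs_of_nonneg (sub_nonneg.2 hr.2)] at h1
      exact hra (le_antisymm (by linarith) hr.1)
    · rw [uIcc_of_ge h] at hr
      rw [abs_of_nonpos (sub_nonpos.2 h), abs_of_nonpos (sub_nonpos.2 hr.1)] at h1
      exact hra (le_antisymm hr.2 (by linarith))
  · have h1 : (⟨a, haF⟩ : F) ∈ Metric.ball t₀ ε := by
      rw [Metric.mem_ball, Subtype.dist_eq, Real.dist_eq]
      rw [Metric.mem_ball, Real.dist_eq] at hsε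
      exact (abs_sub_left_of_mem_uIcc has).trans_lt hsε
    exact (hball h1).2.taylorBound (H.u_deriv a haF.1)

theorem isAdjoint_deriv [FiniteDimensional ℝ V]
    (H : IsTransportSolution T L B f Df q Dq u Du) {X : ℝ → V} (hX : IsCharacteristic T f X) :
    IsAdjoint T Df Dq X (fun t => Du t (X t)) := by
  have h0 : (0 : ℝ) ∈ Icc 0 T := ⟨le_rfl, H.T_nonneg⟩
  obtain ⟨p, hp, hp0⟩ := H.exists_isAdjoint hX h0 (Du 0 (X 0))
  have heq : ∀ s ∈ Icc 0 T, Du s (X s) = p s := fun s hs =>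
    H.deriv_eq_of_isAdjoint h0 hs (fun r hr _ => H.isTameAt (uIcc_subset_Icc h0 hs hr)) hX hp hp0
  intro t ht
  have := (hp t ht).congr heq (heq t ht)
  rwa [← heq t ht] at this

theorem norm_deriv_le [FiniteDimensional ℝ V]
    (H : IsTransportSolution T L B f Df q Dq u Du) {L₀ : ℝ} (h₀ : ∀ x, ‖Du 0 x‖ ≤ L₀)
    {t : ℝ} (ht : t ∈ Icc 0 T) (x : V) :
    ‖Du t x‖ ≤ (L₀ + t * L) * Real.exp (t * L) := by
  have : CompleteSpace V := FiniteDimensional.complete ℝ V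
  obtain ⟨X, hX, rfl⟩ := H.exists_characteristic ht x
  have key := H.norm_isAdjoint_le (H.isAdjoint_deriv hX) ⟨le_rfl, H.T_nonneg⟩ ht
  rw [sub_zero, abs_of_nonneg ht.1, mul_comm L t] at key
  refine key.trans ?_
  gcongr
  exact h₀ _

theorem norm_deriv_sub_le [FiniteDimensional ℝ V]
    (H : IsTransportSolution T L B f Df q Dq u Du) {L₀ : ℝ} (hL₀ : 0 ≤ L₀)
    (h₀ : ∀ x, ‖Du 0 x‖ ≤ L₀) (h₁ : ∀ x y, ‖Du 0 x - Du 0 y‖ ≤ L₀ * ‖x - y‖)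
    {t : ℝ} (ht : t ∈ Icc 0 T) (x y : V) :
    ‖Du t x - Du t y‖ ≤
      (L₀ + t * (L + ((L₀ + T * L) * Real.exp (T * L)) * L)) * Real.exp (2 * t * L) *
        ‖x - y‖ := by
  have : CompleteSpace V := FiniteDimensional.complete ℝ V
  have hL := H.L_nonneg
  have hT := H.T_nonneg
  have h0 : (0 : ℝ) ∈ Icc 0 T := ⟨le_rfl, hT⟩
  obtain ⟨X, hX, rfl⟩ := H.exists_characteristic ht x
  obtain ⟨Y, hY, rfl⟩ := H.exists_characteristic ht y
  set B₁ := (L₀ + T * L) * Real.exp (T * L)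
  have hB₁ : 0 ≤ B₁ := by positivity
  have hDu : ∀ s ∈ Icc 0 T, ∀ z, ‖Du s z‖ ≤ B₁ := fun s hs z => by
    refine (H.norm_deriv_le h₀ hs z).trans ?_
    have := hs.2
    simp only [B₁]
    gcongr
  set G := Real.exp (L * t) * ‖X t - Y t‖
  have hXY : ∀ s ∈ Icc 0 t, ‖X s - Y s‖ ≤ G := fun s hs => by
    refine (H.norm_characteristic_sub_le hX hY ⟨hs.1, hs.2.trans ht.2⟩ ht).trans ?_
    simp only [G]
    gcongr
    rw [abs_sub_comm, abs_of_nonneg (sub_nonneg.2 hs.2)]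
    linarith [hs.1]
  have hsub : Icc 0 t ⊆ Icc 0 T := Icc_subset_Icc_right ht.2
  have key := norm_le_of_norm_hasDerivWithinAt_le (a := 0) (b := t)
    (g := fun s => Du s (X s) - Du s (Y s)) (K := L) (ε := (L + B₁ * L) * G) hL (by positivity)
    (fun s hs => ((H.isAdjoint_deriv hX s (hsub hs)).sub
      (H.isAdjoint_deriv hY s (hsub hs))).mono hsub)
    (fun s hs => by
      have hsT := hsub hs
      have e : -((Du s (X s)).comp (Df s (X s))) - Dq s (X s) -
          (-((Du s (Y s)).comp (Df s (Y s))) - Dq s (Y s)) =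
          -((Du s (X s) - Du s (Y s)).comp (Df s (X s)) +
            (Du s (Y s)).comp (Df s (X s) - Df s (Y s)) + (Dq s (X s) - Dq s (Y s))) := by
        ext v
        simp
        ring
      rw [e, norm_neg]
      refine (norm_add₃_le).trans ?_
      have e1 : ‖(Du s (X s) - Du s (Y s)).comp (Df s (X s))‖ ≤
          L * ‖Du s (X s) - Du s (Y s)‖ := by
        refine (ContinuousLinearMap.opNorm_comp_le _ _).trans ?_
        rw [mul_comm]
        gcongr
        exact H.Df_le s hsT _
      have e2 : ‖(Du s (Y s)).comp (Df s (X s) - Df s (Y s))‖ ≤ B₁ * (L * G) := by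
        refine (ContinuousLinearMap.opNorm_comp_le _ _).trans ?_
        refine mul_le_mul (hDu s hsT _) ((H.Df_lip s hsT _ _).trans ?_) (norm_nonneg _) hB₁
        gcongr
        exact hXY s hs
      have e3 : ‖Dq s (X s) - Dq s (Y s)‖ ≤ L * G := by
        refine (H.Dq_lip s hsT _ _).trans ?_
        gcongr
        exact hXY s hs
      linarith)
    ⟨le_rfl, ht.1⟩ ⟨ht.1, le_rfl⟩
  rw [sub_zero, abs_of_nonneg ht.1] at key
  refine key.trans ?_
  have e1 : ‖Du 0 (X 0) - Du 0 (Y 0)‖ ≤ L₀ * G := by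
    refine (h₁ _ _).trans ?_
    gcongr
    exact hXY 0 ⟨le_rfl, ht.1⟩
  calc _ ≤ (L₀ * G + (L + B₁ * L) * G * t) * Real.exp (L * t) := by gcongr
    _ = (L₀ + t * (L + B₁ * L)) * (Real.exp (L * t) * Real.exp (L * t)) * ‖X t - Y t‖ := by
        simp only [G]; ring
    _ = _ := by rw [← Real.exp_add]; ring_nf

end IsTransportSolution

end Transport

section Periodic

open Filter Topology

variable {d : ℕ} {l : ℝ}

theorem IsPeriodic.comp {β γ : Type*} {g : E d → β} (hg : IsPeriodic l g) (h : β → γ) :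
    IsPeriodic l (fun x => h (g x)) := fun x i => congrArg h (hg x i)

theorem IsPeriodic.fderiv {W : Type*} [NormedAddCommGroup W] [NormedSpace ℝ W] {g : E d → W}
    (hg : IsPeriodic l g) : IsPeriodic l (fun x => fderiv ℝ g x) := fun x i => by
  have h : (fun y => g (y + l • uvec d i)) = g := funext fun y => hg y i
  have h1 := fderiv_comp_add_right (𝕜 := ℝ) (f := g) (x := x) (l • uvec d i)
  rw [h] at h1
  exact h1.symm

theorem IsPeriodic.gradient {g : E d → ℝ} (hg : IsPeriodic l g) :
    IsPeriodic l (fun x => gradient g x) :=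
  hg.fderiv.comp (InnerProductSpace.toDual ℝ (E d)).symm

theorem IsPeriodic.diverg {F : E d → E d} (hF : IsPeriodic l F) :
    IsPeriodic l (fun x => diverg F x) :=
  hF.fderiv.comp fun A : E d →L[ℝ] E d => ∑ i, A (uvec d i) i

theorem IsPeriodic.forall_of_forall_mem_box (hl : 0 < l) {P : E d → Prop} (hP : IsPeriodic l P)
    (h : ∀ x ∈ box d l, P x) (x : E d) : P x := by
  let k : Fin d → ℤ := fun i => -⌊x i / l + 1 / 2⌋
  have hs : ∀ s : Finset (Fin d), P (x + ∑ i ∈ s, k i • l • uvec d i) = P x := by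
    intro s
    induction s using Finset.induction_on with
    | empty => simp
    | insert j s hj ih =>
      rw [Finset.sum_insert hj, add_comm (k j • l • uvec d j), ← add_assoc, ← ih]
      have hper : Function.Periodic P (l • uvec d j) := fun y => hP y j
      exact hper.zsmul (k j) _
  rw [← hs Finset.univ]
  refine h _ fun j => ?_
  have hj : (x + ∑ i, k i • l • uvec d i) j = x j - ⌊x j / l + 1 / 2⌋ * l := by
    simp [uvec, k, Pi.single_apply, sub_eq_add_neg, mul_comm]
  rw [hj]
  have h1 := Int.floor_le (x j / l + 1 / 2)
  have h2 := Int.lt_floor_add_one (x j / l + 1 / 2)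
  have h3 : x j / l * l = x j := div_mul_cancel₀ _ hl.ne'
  constructor <;> nlinarith

theorem isCompact_box (d : ℕ) (l : ℝ) : IsCompact (box d l) := by
  have h1 : IsCompact (Set.univ.pi fun _ : Fin d => Icc (-(l / 2)) (l / 2)) :=
    isCompact_univ_pi fun _ => isCompact_Icc
  have h2 := (EuclideanSpace.equiv (Fin d) ℝ).toHomeomorph.isCompact_preimage.2 h1
  convert h2 using 1
  ext x
  exact ⟨fun h i _ => h i, fun h i => h i (mem_univ i)⟩

theorem IsPeriodic.exists_norm_le {W : Type*} [NormedAddCommGroup W] {g : E d → W} (hl : 0 < l)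
    (hg : IsPeriodic l g) (hc : Continuous g) : ∃ C, 0 ≤ C ∧ ∀ x, ‖g x‖ ≤ C := by
  obtain ⟨C, hC⟩ := (isCompact_box d l).exists_bound_of_continuousOn hc.continuousOn
  exact ⟨max C 0, le_max_right _ _, (hg.comp fun w => ‖w‖ ≤ max C 0).forall_of_forall_mem_box hl
    fun x hx => (hC x hx).trans (le_max_left _ _)⟩

theorem exists_taylorBound_of_isPeriodic (hl : 0 < l) {g : E d → ℝ} (hg : IsPeriodic l g)
    (hsm : ContDiff ℝ 2 g) : ∃ N, 0 ≤ N ∧ TaylorBound g (fderiv ℝ g) N := by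
  have h1 : ContDiff ℝ 1 (fderiv ℝ g) := hsm.fderiv_right (by norm_num)
  obtain ⟨C₁, hC₁, hb₁⟩ := hg.fderiv.exists_norm_le hl h1.continuous
  obtain ⟨C₂, -, hb₂⟩ := hg.fderiv.fderiv.exists_norm_le hl (h1.continuous_fderiv one_ne_zero)
  have hd : ∀ x, HasFDerivAt g (fderiv ℝ g x) x := fun x =>
    (hsm.differentiable two_ne_zero x).hasFDerivAt
  have hd' : ∀ x, HasFDerivAt (fderiv ℝ g) (fderiv ℝ (fderiv ℝ g) x) x := fun x =>
    (h1.differentiable one_ne_zero x).hasFDerivAt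
  have hN : 0 ≤ max C₁ C₂ := le_max_of_le_left hC₁
  exact ⟨max C₁ C₂, hN,
    norm_sub_le_of_norm_deriv_le hd fun x => (hb₁ x).trans (le_max_left _ _),
    taylor_of_lipschitz_deriv hN hd
      (norm_sub_le_of_norm_deriv_le hd' fun x => (hb₂ x).trans (le_max_right _ _))⟩

end Periodic

section Application

variable {d : ℕ}

theorem norm_gradient_eq (g : E d → ℝ) (x : E d) : ‖gradient g x‖ = ‖fderiv ℝ g x‖ :=
  (InnerProductSpace.toDual ℝ (E d)).symm.norm_map _

theorem norm_gradient_sub_gradient (g : E d → ℝ) (x y : E d) :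
    ‖gradient g x - gradient g y‖ = ‖fderiv ℝ g x - fderiv ℝ g y‖ := by
  unfold gradient
  rw [← map_sub, LinearIsometryEquiv.norm_map]

theorem contDiff_gradient {g : E d → ℝ} (hg : ContDiff ℝ 2 g) :
    ContDiff ℝ 1 (fun x => gradient g x) :=
  (InnerProductSpace.toDual ℝ (E d)).symm.contDiff.comp (hg.fderiv_right (by norm_num))

theorem norm_fderiv_sub_le_of_norm_fderiv_gradient_le {g : E d → ℝ} {L : ℝ}
    (hg : ContDiff ℝ 2 g) (h : ∀ x, ‖fderiv ℝ (fun y => gradient g y) x‖ ≤ L) (x y : E d) :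
    ‖fderiv ℝ g x - fderiv ℝ g y‖ ≤ L * ‖x - y‖ := by
  rw [← norm_gradient_sub_gradient]
  exact norm_sub_le_of_norm_deriv_le (fun z =>
    ((contDiff_gradient hg).differentiable one_ne_zero z).hasFDerivAt) h x y

theorem contDiff_diverg {F : E d → E d} {n m : WithTop ℕ∞} (hF : ContDiff ℝ n F)
    (hmn : m + 1 ≤ n) : ContDiff ℝ m (fun x => diverg F x) := by
  unfold diverg
  have h1 : ContDiff ℝ m (fderiv ℝ F) := hF.fderiv_right hmn
  refine ContDiff.sum fun i _ => ?_
  exact (EuclideanSpace.proj (𝕜 := ℝ) i).contDiff.comp (h1.clm_apply contDiff_const)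

theorem diverg_smul {r : E d → ℝ} {F : E d → E d} {x : E d} (hr : DifferentiableAt ℝ r x)
    (hF : DifferentiableAt ℝ F x) :
    diverg (fun y => r y • F y) x = r x * diverg F x + fderiv ℝ r x (F x) := by
  have h1 : fderiv ℝ (fun y => r y • F y) x =
      r x • fderiv ℝ F x + (fderiv ℝ r x).smulRight (F x) := fderiv_fun_smul hr hF
  have h2 : F x = ∑ i, F x i • uvec d i := by
    have := (EuclideanSpace.basisFun (Fin d) ℝ).sum_repr (F x)
    simpa [uvec] using this.symm
  have h3 : fderiv ℝ r x (F x) = ∑ i, fderiv ℝ r x (uvec d i) * F x i := by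
    conv_lhs => rw [h2]
    simp [mul_comm]
  unfold diverg
  rw [h1, h3, Finset.mul_sum, ← Finset.sum_add_distrib]
  simp

theorem isTransportSolution_log {l T L : ℝ} (hl : 0 < l) (hT : 0 ≤ T) (hL : 0 ≤ L)
    {f : ℝ → E d → E d} (hf : ∀ t, ContDiff ℝ 3 (f t))
    (hfcont : Continuous (Function.uncurry f))
    (hfper : ∀ t ∈ Icc (0 : ℝ) T, IsPeriodic l (f t))
    (hbound : ∀ t ∈ Icc (0 : ℝ) T, ∀ x ∈ box d l,
      ‖fderiv ℝ (f t) x‖ ≤ L ∧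
      ‖fderiv ℝ (fun y => fderiv ℝ (f t) y) x‖ ≤ L ∧
      ‖gradient (fun y => diverg (f t) y) x‖ ≤ L ∧
      ‖fderiv ℝ (fun y => gradient (fun z => diverg (f t) z) y) x‖ ≤ L)
    {ρ : ℝ → E d → ℝ} (hρ : ∀ t, ContDiff ℝ 2 (ρ t)) (hρpos : ∀ t x, 0 < ρ t x)
    (hρper : ∀ t ∈ Icc (0 : ℝ) T, IsPeriodic l (ρ t))
    (hCE : ∀ t x, HasDerivAt (fun τ => ρ τ x) (-(diverg (fun y => ρ t y • f t y) x)) t) :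
    ∃ B, IsTransportSolution T L B f (fun t x => fderiv ℝ (f t) x) (fun t x => diverg (f t) x)
      (fun t x => fderiv ℝ (fun y => diverg (f t) y) x) (fun t x => Real.log (ρ t x))
      (fun t x => fderiv ℝ (fun y => Real.log (ρ t y)) x) := by
  obtain ⟨B, hB⟩ := (isCompact_Icc.prod (isCompact_box d l)).exists_bound_of_continuousOn
    (hfcont.continuousOn (s := Icc 0 T ×ˢ box d l))
  have hfc : ∀ x, ContinuousOn (f · x) (Icc 0 T) := fun x =>
    (hfcont.comp (Continuous.prodMk_left x)).continuousOn
  have hfd : ∀ t x, HasFDerivAt (f t) (fderiv ℝ (f t) x) x := fun t x =>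
    ((hf t).differentiable three_ne_zero x).hasFDerivAt
  have hDf : ∀ t x, HasFDerivAt (fun y => fderiv ℝ (f t) y)
      (fderiv ℝ (fun y => fderiv ℝ (f t) y) x) x := fun t x =>
    (((hf t).fderiv_right (m := 2) (by norm_num)).differentiable two_ne_zero x).hasFDerivAt
  have hDlip : ∀ t ∈ Icc 0 T, ∀ x y, ‖fderiv ℝ (f t) x - fderiv ℝ (f t) y‖ ≤ L * ‖x - y‖ :=
    fun t ht => norm_sub_le_of_norm_deriv_le (hDf t)
      (((hfper t ht).fderiv.fderiv.comp fun w => ‖w‖ ≤ L).forall_of_forall_mem_box hl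
        fun x hx => (hbound t ht x hx).2.1)
  have hq : ∀ t, ContDiff ℝ 2 fun x => diverg (f t) x := fun t =>
    contDiff_diverg (hf t) (by norm_num)
  have hlog : ∀ t, ContDiff ℝ 2 fun x => Real.log (ρ t x) := fun t =>
    (hρ t).log fun x => (hρpos t x).ne'
  refine ⟨B, hT, hL, hfc, fun t _ => hfd t, fun t ht => ?_, fun t ht => ?_, hDlip, fun x => ?_,
    fun t _ x => ((hq t).differentiable two_ne_zero x).hasFDerivAt, fun t ht => ?_,
    fun t ht => ?_, fun t _ x => ((hlog t).differentiable two_ne_zero x).hasFDerivAt,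
    fun t _ x => ?_, fun t ht => ?_⟩
  · exact ((hfper t ht).comp fun w => ‖w‖ ≤ B).forall_of_forall_mem_box hl
      fun x hx => hB (t, x) ⟨ht, hx⟩
  · exact ((hfper t ht).fderiv.comp fun w => ‖w‖ ≤ L).forall_of_forall_mem_box hl
      fun x hx => (hbound t ht x hx).1
  · have h1 : ContinuousOn (fun t => fderiv ℝ (f t) x) (Icc 0 T) :=
      continuousOn_deriv_of_taylor
        (fun t ht => taylor_of_lipschitz_deriv hL (hfd t) (hDlip t ht) x) hfc
    unfold diverg
    refine continuousOn_finsetSum _ fun i _ => ?_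
    exact (EuclideanSpace.proj (𝕜 := ℝ) i).continuous.comp_continuousOn
      (h1.clm_apply continuousOn_const)
  · refine ((hfper t ht).diverg.fderiv.comp fun w => ‖w‖ ≤ L).forall_of_forall_mem_box hl
      fun x hx => ?_
    rw [← norm_gradient_eq]
    exact (hbound t ht x hx).2.2.1
  · exact norm_fderiv_sub_le_of_norm_fderiv_gradient_le (hq t)
      (((hfper t ht).diverg.gradient.fderiv.comp fun w => ‖w‖ ≤ L).forall_of_forall_mem_box hl
        fun x hx => (hbound t ht x hx).2.2.2)
  · have hr := (hρ t).differentiable two_ne_zero x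
    have h1 := (hCE t x).log (hρpos t x).ne'
    rw [diverg_smul hr (hfd t x).differentiableAt] at h1
    refine h1.hasDerivWithinAt.congr_deriv ?_
    rw [fderiv.log hr (hρpos t x).ne']
    have := (hρpos t x).ne'
    simp only [_root_.smul_apply, smul_eq_mul]
    field_simp
    ring
  · exact exists_taylorBound_of_isPeriodic hl ((hρper t ht).comp Real.log) (hlog t)

end Application

/-- Hessian bound for the log-density: if `‖∇log α₀‖, ‖∇²log α₀‖ ≤ L₀`
on `𝒳` and `‖∇^i f‖, ‖∇^i div f‖ ≤ L_f` for `i ∈ {1,2}` on `[0,T] × 𝒳`, with everything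
`l`-periodic, then `‖∇²log ρ_t(x)‖ ≤ (L₀ + t(L_f + B₁ L_f)) exp(2 t L_f)` on `[0,T] × 𝒳`,
where `B₁ = (L₀ + T L_f) exp(T L_f)`; in particular `∇log ρ_t` is Lipschitz on `𝒳`,
uniformly over `t ∈ [0,T]`. -/
theorem hessian_log_density_bound_transported_density
    (d : ℕ) (l T L₀ Lf : ℝ) (hl : 0 < l) (hT : 0 < T) (hL₀ : 0 ≤ L₀) (hLf : 0 ≤ Lf)
    (f : ℝ → E d → E d) (K : NNReal)
    (hfsmooth : ∀ t, ContDiff ℝ (⊤ : ℕ∞) (f t))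
    (hfcont : Continuous (Function.uncurry f))
    (hfLip : ∀ t, LipschitzWith K (f t))
    (hfper : ∀ t ∈ Icc (0 : ℝ) T, IsPeriodic l (f t))
    (hfbound : ∀ t ∈ Icc (0 : ℝ) T, ∀ x ∈ box d l,
      ‖fderiv ℝ (f t) x‖ ≤ Lf ∧
      ‖fderiv ℝ (fun y => fderiv ℝ (f t) y) x‖ ≤ Lf ∧
      ‖gradient (fun y => diverg (f t) y) x‖ ≤ Lf ∧
      ‖fderiv ℝ (fun y => gradient (fun z => diverg (f t) z) y) x‖ ≤ Lf)
    (α₀ : E d → ℝ)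
    (hα₀smooth : ContDiff ℝ (⊤ : ℕ∞) α₀) (hα₀pos : ∀ x, 0 < α₀ x)
    (hα₀per : IsPeriodic l α₀)
    (hα₀prob : ∫ x in box d l, α₀ x = 1)
    (hα₀bound : ∀ x ∈ box d l,
      ‖score α₀ x‖ ≤ L₀ ∧ ‖fderiv ℝ (score α₀) x‖ ≤ L₀)
    (ρ : ℝ → E d → ℝ)
    (hρsmooth : ∀ t, ContDiff ℝ (⊤ : ℕ∞) (ρ t)) (hρpos : ∀ t x, 0 < ρ t x)
    (hρper : ∀ t ∈ Icc (0 : ℝ) T, IsPeriodic l (ρ t))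
    (hρ0 : ρ 0 = α₀)
    (hCE : ∀ t x, HasDerivAt (fun τ => ρ τ x)
      (-(diverg (fun y => ρ t y • f t y) x)) t) :
    (∀ t ∈ Icc (0 : ℝ) T, ∀ x ∈ box d l,
      ‖fderiv ℝ (score (ρ t)) x‖ ≤
        (L₀ + t * (Lf + ((L₀ + T * Lf) * Real.exp (T * Lf)) * Lf)) *
          Real.exp (2 * t * Lf)) ∧
    (∀ t ∈ Icc (0 : ℝ) T,
      LipschitzOnWith
        (Real.toNNReal
          ((L₀ + T * (Lf + ((L₀ + T * Lf) * Real.exp (T * Lf)) * Lf)) *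
            Real.exp (2 * T * Lf)))
        (score (ρ t)) (box d l)) := by
  obtain ⟨B, H⟩ := isTransportSolution_log hl hT.le hLf (fun t => contDiff_infty.1 (hfsmooth t) 3)
    hfcont hfper hfbound (fun t => contDiff_infty.1 (hρsmooth t) 2) hρpos hρper hCE
  have hα₀log : IsPeriodic l fun x => Real.log (α₀ x) := hα₀per.comp Real.log
  have h₀ : ∀ x, ‖fderiv ℝ (fun y => Real.log (ρ 0 y)) x‖ ≤ L₀ := by
    rw [hρ0]
    refine (hα₀log.fderiv.comp fun w => ‖w‖ ≤ L₀).forall_of_forall_mem_box hl fun x hx => ?_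
    rw [← norm_gradient_eq]
    exact (hα₀bound x hx).1
  have h₁ : ∀ x y, ‖fderiv ℝ (fun z => Real.log (ρ 0 z)) x -
      fderiv ℝ (fun z => Real.log (ρ 0 z)) y‖ ≤ L₀ * ‖x - y‖ := by
    rw [hρ0]
    exact norm_fderiv_sub_le_of_norm_fderiv_gradient_le
      ((contDiff_infty.1 hα₀smooth 2).log fun x => (hα₀pos x).ne')
      ((hα₀log.gradient.fderiv.comp fun w => ‖w‖ ≤ L₀).forall_of_forall_mem_box hl
        fun x hx => (hα₀bound x hx).2)
  have key : ∀ t ∈ Icc (0 : ℝ) T, ∀ x y, ‖score (ρ t) x - score (ρ t) y‖ ≤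
      (L₀ + t * (Lf + ((L₀ + T * Lf) * Real.exp (T * Lf)) * Lf)) * Real.exp (2 * t * Lf) *
        ‖x - y‖ := fun t ht x y =>
    (norm_gradient_sub_gradient _ x y).trans_le (H.norm_deriv_sub_le hL₀ h₀ h₁ ht x y)
  refine ⟨fun t ht x _ => ?_, fun t ht => ?_⟩
  · have := ht.1
    exact norm_fderiv_le_of_lip' ℝ (by positivity)
      (Filter.Eventually.of_forall fun y => key t ht y x)
  · refine LipschitzOnWith.of_dist_le_mul fun x _ y _ => ?_
    rw [Real.coe_toNNReal _ (by positivity), dist_eq_norm, dist_eq_norm]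
    refine (key t ht x y).trans ?_
    have := ht.1
    have := ht.2
    gcongr
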